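/- Let A be a finite abelian group of order m and let s be a real number with s > 1/a(A). Then there exist constants C and C₀, depending only on A and s, with the following property: for every tame local specification Λ consisting of finitely many primes p not dividing 6m together with, for each such p, a non-identity element b_p of A prescribed to generate the inertia subgroup at p, the Dirichlet value g_Λ(s) = Σ_L Disc(L)^{−s}, summed over isomorphism classes of A-extensions L/ℚ satisfying Λ, satisfies g_Λ(s) ≤ C₀ · ∏_{p ∈ Λ} C·p^{−ind(b_p)·s}. -/

import Mathlib

open scoped Classical NumberField

noncomputable section

local notation "Qbar" => AlgebraicClosure ℚ

/-- The index of an element of a finite group acting on itself by the regular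
representation on `|A|` letters: `ind(g) = |A| - (number of orbits of g) = |A| - |A|/ord(g)`. -/
def ind (A : Type*) [Group A] [Fintype A] (g : A) : ℕ :=
  Fintype.card A - Fintype.card A / orderOf g

/-- `a(A)`: the minimal index of a non-identity element of `A`. -/
def minInd (A : Type*) [Group A] [Fintype A] : ℕ :=
  sInf {n : ℕ | ∃ g : A, g ≠ 1 ∧ ind A g = n}

/-- An `A`-extension of `ℚ`: a finite Galois subfield `L` of `Qbar` together with an
isomorphism `Gal(L/ℚ) ≃* A`.  Since `A` is abelian, such pairs are in natural bijection
with the isomorphism classes of `A`-extensions of `ℚ`. -/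
structure AExtension (A : Type*) [CommGroup A] where
  L : IntermediateField ℚ Qbar
  fd : FiniteDimensional ℚ L
  gal : IsGalois ℚ L
  ψ : (L ≃ₐ[ℚ] L) ≃* A

/-- `Disc(L)`: the absolute value of the discriminant of a number field
(junk value `0` in the infinite-dimensional case). -/
def absDisc (K : IntermediateField ℚ Qbar) : ℕ :=
  if h : FiniteDimensional ℚ K then
    haveI := h
    haveI : NumberField K := ⟨⟩
    (NumberField.discr K).natAbs
  else 0

/-- `E` satisfies the tame local specification given by the finite set `Λ` of primes and
the prescribed inertia generators `b p`: at each `p ∈ Λ` there is a prime `P` of `𝒪_L`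
above `p` such that the inertia subgroup at `P` (the set of automorphisms `σ` with
`σ x ≡ x mod P` for all integral `x`) corresponds under `ψ` exactly to the cyclic
subgroup generated by `b p`; in particular `L` is ramified at `p` when `b p ≠ 1`. -/
def SatisfiesSpec {A : Type*} [CommGroup A] (E : AExtension A)
    (Λ : Finset ℕ) (b : ℕ → A) : Prop :=
  ∀ p ∈ Λ, ∃ P : Ideal (𝓞 E.L), P.IsPrime ∧ (p : 𝓞 E.L) ∈ P ∧
    ∀ σ : E.L ≃ₐ[ℚ] E.L,
      ((∀ x : 𝓞 E.L, ∃ y ∈ P, (y : E.L) = σ (x : E.L) - (x : E.L)) ↔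
        E.ψ σ ∈ Subgroup.zpowers (b p))

section TameInertia

variable {S G : Type*} [CommRing S] [Group G] [MulSemiringAction G S] {P : Ideal S}

theorem Ideal.smul_mem_pow_of_mem_inertia {σ : G} (hσ : σ ∈ P.inertia G) {k : ℕ} {x : S}
    (hx : x ∈ P ^ k) : σ • x ∈ P ^ k := by
  have hP : P ≤ P.comap (MulSemiringAction.toRingHom G S σ) := fun y hy ↦ by
    simpa using P.add_mem (hσ y) hy
  have := Ideal.pow_right_mono (Ideal.map_le_iff_le_comap.mpr hP) k
  rw [← Ideal.map_pow] at this
  exact this (Ideal.mem_map_of_mem _ hx)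

variable [IsDedekindDomain S]

/-- An element of the inertia group acts on `P / P ^ 2` by a scalar. If this scalar is trivial,
then so is the action on all quotients `P ^ k / P ^ (k + 1)`. -/
theorem Ideal.smul_sub_mem_pow_succ_of_mem_inertia {σ : G} (hσ : σ ∈ P.inertia G) (hP : P ≠ ⊥)
    [P.IsPrime] {π : S} (hπ : π ∈ P) (hπ' : π ∉ P ^ 2) (hσπ : σ • π - π ∈ P ^ 2) {k : ℕ} {x : S}
    (hx : x ∈ P ^ k) : σ • x - x ∈ P ^ (k + 1) := by
  induction k generalizing x with
  | zero => simpa using hσ x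
  | succ k ih =>
    rw [pow_succ] at hx
    induction hx using Submodule.mul_induction_on' with
    | mem_mul_mem a ha b hb =>
      obtain ⟨d, e, he, rfl⟩ := Ideal.exists_mul_add_mem_pow_succ (i := 1) hP π b
        (by simpa using hπ) hπ' (by simpa using hb)
      have hd : σ • (π * d + e) - (π * d + e) ∈ P ^ 2 := by
        have h1 : σ • e ∈ P ^ 2 := smul_mem_pow_of_mem_inertia hσ he
        have h2 : σ • π * (σ • d - d) ∈ P ^ 2 := by
          rw [pow_two]
          exact Ideal.mul_mem_mul
            (by simpa using smul_mem_pow_of_mem_inertia (k := 1) hσ (by simpa using hπ)) (hσ d)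
        have h3 : (σ • π - π) * d ∈ P ^ 2 := Ideal.mul_mem_right _ _ hσπ
        have : σ • (π * d + e) - (π * d + e) =
            σ • π * (σ • d - d) + (σ • π - π) * d + σ • e - e := by
          rw [smul_add, smul_mul']; ring
        rw [this]
        exact Ideal.sub_mem _ (Ideal.add_mem _ (Ideal.add_mem _ h2 h3) h1) he
      generalize π * d + e = c at hb hd
      have h1 : (σ • a - a) * σ • c ∈ P ^ (k + 1 + 1) := by
        rw [pow_succ P (k + 1)]
        exact Ideal.mul_mem_mul (ih ha)
          (by simpa using smul_mem_pow_of_mem_inertia (k := 1) hσ (by simpa using hb))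
      have h2 : a * (σ • c - c) ∈ P ^ (k + 1 + 1) := by
        rw [add_assoc, pow_add]
        exact Ideal.mul_mem_mul ha hd
      have : σ • (a * c) - a * c = (σ • a - a) * σ • c + a * (σ • c - c) := by
        rw [smul_mul']; ring
      rw [this]
      exact Ideal.add_mem _ h1 h2
    | add y _ z _ hy hz =>
      rw [smul_add, add_sub_add_comm]
      exact Ideal.add_mem _ hy hz

theorem Ideal.smul_sub_mem_pow_of_mem_inertia {σ : G} (hσ : σ ∈ P.inertia G) (hP : P ≠ ⊥)
    [P.IsPrime] {π : S} (hπ : π ∈ P) (hπ' : π ∉ P ^ 2) (hσπ : σ • π - π ∈ P ^ 2) {m : ℕ}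
    (hm : σ ^ m = 1) (hmP : (m : S) ∉ P) (k : ℕ) (x : S) : σ • x - x ∈ P ^ k := by
  induction k with
  | zero => simp
  | succ k ih =>
    have key (n : ℕ) : σ ^ n • x - x - n * (σ • x - x) ∈ P ^ (k + 1) := by
      induction n with
      | zero => simp
      | succ n hn =>
        have h1 := smul_sub_mem_pow_succ_of_mem_inertia hσ hP hπ hπ' hσπ ih
        have h2 := smul_mem_pow_of_mem_inertia hσ hn
        have h3 : (n : S) * (σ • (σ • x - x) - (σ • x - x)) ∈ P ^ (k + 1) :=
          Ideal.mul_mem_left _ _ h1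
        have h4 : σ • (n : S) = n := map_natCast (MulSemiringAction.toRingHom G S σ) n
        convert Ideal.add_mem _ h2 h3 using 1
        rw [pow_succ', mul_smul, smul_sub, smul_sub, smul_mul', h4]
        push_cast
        ring
    have := key m
    rw [hm, one_smul, sub_self, zero_sub, neg_mem_iff] at this
    exact ((Ideal.IsPrime.mul_mem_pow P this).resolve_left hmP)

/-- Tame inertia is cyclic. -/
theorem Ideal.isCyclic_inertia_of_pow_eq_one [Finite G] [FaithfulSMul G S] (hP : P ≠ ⊥) [P.IsPrime]
    {m : ℕ} (hm : ∀ σ ∈ P.inertia G, σ ^ m = 1) (hmP : (m : S) ∉ P) :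
    IsCyclic (P.inertia G) := by
  obtain ⟨π, hπ, hπ'⟩ := Ideal.exists_mem_pow_notMem_pow_succ P hP (Ideal.IsPrime.ne_top ‹_›) 1
  have hπ₁ : π ∈ P := by simpa using hπ
  have hex (σ : P.inertia G) : ∃ d : S, σ • π - π * d ∈ P ^ 2 := by
    obtain ⟨d, e, he, h⟩ := Ideal.exists_mul_add_mem_pow_succ hP π (σ • π) hπ hπ'
      (smul_mem_pow_of_mem_inertia σ.2 hπ)
    exact ⟨d, by rw [← h]; simpa using he⟩
  choose u hu using hex
  have huniq {d d' : S} (h : π * d - π * d' ∈ P ^ 2) : d - d' ∈ P :=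
    Ideal.mul_add_mem_pow_succ_unique hP π d d' 0 0 hπ' (zero_mem _) (zero_mem _) (by simpa using h)
  let f : P.inertia G →* S ⧸ P :=
    { toFun σ := Ideal.Quotient.mk P (u σ)
      map_one' := by
        rw [← map_one (Ideal.Quotient.mk P), Ideal.Quotient.eq]
        have := hu 1
        rw [one_smul] at this
        exact huniq (by simpa using neg_mem this)
      map_mul' σ τ := by
        rw [← map_mul, Ideal.Quotient.eq]
        apply huniq
        have h1 := hu (σ * τ)
        have h2 : σ • (τ • π - π * u τ) ∈ P ^ 2 := smul_mem_pow_of_mem_inertia σ.2 (hu τ)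
        have h3 : (σ • π - π * u σ) * u τ ∈ P ^ 2 := Ideal.mul_mem_right _ _ (hu σ)
        have h4 : σ • π * (σ • u τ - u τ) ∈ P ^ 2 := by
          rw [pow_two]
          exact Ideal.mul_mem_mul
            (by simpa [Subgroup.smul_def] using smul_mem_pow_of_mem_inertia (k := 1) σ.2 hπ) (σ.2 _)
        convert Ideal.sub_mem _ (Ideal.add_mem _ (Ideal.add_mem _ h2 h3) h4) h1 using 1
        rw [smul_sub, smul_mul', mul_smul]
        ring }
  refine isCyclic_of_injective_ringHom f ((injective_iff_map_eq_one f).mpr fun σ hσ ↦ ?_)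
  have hσπ : (σ : G) • π - π ∈ P ^ 2 := by
    have h1 : u σ - 1 ∈ P := by rwa [← Ideal.Quotient.eq, map_one]
    have h2 : π * (u σ - 1) ∈ P ^ 2 := by
      rw [pow_two]
      exact Ideal.mul_mem_mul hπ₁ h1
    convert Ideal.add_mem _ (hu σ) h2 using 1
    rw [Subgroup.smul_def]
    ring
  refine Subtype.ext (FaithfulSMul.eq_of_smul_eq_smul (α := S) fun x ↦ ?_)
  rw [OneMemClass.coe_one, one_smul, ← sub_eq_zero, ← Ideal.mem_bot,
    ← Ideal.iInf_pow_eq_bot_of_isDomain P (Ideal.IsPrime.ne_top ‹_›), Ideal.mem_iInf]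
  exact fun k ↦ smul_sub_mem_pow_of_mem_inertia σ.2 hP hπ₁ hπ' hσπ (hm σ σ.2) hmP k x

end TameInertia

section InertiaCard

theorem Ideal.card_inertia_eq_ramificationIdx {R S G : Type*} [CommRing R] [CommRing S]
    [Algebra R S] [Group G] [MulSemiringAction G S] [IsGaloisGroup G R S] [Finite G] [IsDomain R]
    [IsDomain S] [Module.Finite R S] [Module.Flat R S] (P : Ideal S) [P.IsPrime]
    [Finite (R ⧸ P.under R)] : Nat.card (P.inertia G) = P.ramificationIdx R := by
  have : (P.under R).IsMaximal := by
    have := Finite.isField_of_domain (R ⧸ P.under R)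
    exact Ideal.Quotient.maximal_of_isField _ this
  have : Finite (P.under R).ResidueField :=
    Finite.of_surjective _ (Ideal.bijective_algebraMap_quotient_residueField (P.under R)).2
  rw [Ideal.card_inertia_eq_ramificationIdxIn (P.under R) P,
    Ideal.ramificationIdxIn_eq_ramificationIdx (P.under R) P G]

theorem NumberField.finite_quotient_under_int {K : Type*} [Field K] {P : Ideal (𝓞 K)} (hP : P ≠ ⊥) :
    Finite (ℤ ⧸ P.under ℤ) :=
  Ring.HasFiniteQuotients.finiteQuotient (mt Ideal.eq_bot_of_comap_eq_bot hP)

theorem NumberField.liesOver_span_of_mem {K : Type*} [Field K] {p : ℕ} (hp : p.Prime)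
    {P : Ideal (𝓞 K)} [P.IsPrime] (hP : (p : 𝓞 K) ∈ P) : P.LiesOver (Ideal.span {(p : ℤ)}) := by
  have : (Ideal.span {(p : ℤ)}).IsMaximal :=
    PrincipalIdealRing.isMaximal_of_irreducible (Nat.prime_iff_prime_int.mp hp).irreducible
  refine ⟨Ideal.IsMaximal.eq_of_le this (Ideal.IsPrime.ne_top inferInstance) ?_⟩
  rw [Ideal.span_singleton_le_iff_mem]
  simpa using hP

variable {K L : Type*} [Field K] [NumberField K] [Field L] [NumberField L]

variable [Algebra K L] [IsGalois ℚ K] [IsGalois ℚ L]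

/-- The inertia group of a number field surjects onto the inertia group of a subfield. -/
theorem NumberField.map_inertia_restrictNormalHom {P : Ideal (𝓞 L)} [P.IsPrime] (hP : P ≠ ⊥) :
    (P.inertia Gal(L/ℚ)).map (AlgEquiv.restrictNormalHom K) =
      (P.under (𝓞 K)).inertia Gal(K/ℚ) := by
  have hK : P.under (𝓞 K) ≠ ⊥ := mt Ideal.eq_bot_of_comap_eq_bot hP
  have : Finite (𝓞 K ⧸ P.under (𝓞 K)) := Ring.HasFiniteQuotients.finiteQuotient hK
  have := finite_quotient_under_int hP
  have := finite_quotient_under_int hK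
  have : IsGalois K L := IsGalois.tower_top_of_isGalois ℚ K L
  refine Subgroup.eq_of_le_of_card_ge ?_ ?_
  · rintro _ ⟨σ, hσ, rfl⟩ x
    have h : algebraMap (𝓞 K) (𝓞 L) (AlgEquiv.restrictNormalHom K σ • x) =
        σ • algebraMap (𝓞 K) (𝓞 L) x :=
      RingOfIntegers.ext (AlgEquiv.restrictNormal_commutes σ K (x : K))
    change algebraMap (𝓞 K) (𝓞 L) _ ∈ P
    rw [map_sub, h]
    exact hσ _
  · have h1 : Nat.card ((P.inertia Gal(L/ℚ)).map (AlgEquiv.restrictNormalHom K)) *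
        Nat.card (P.inertia Gal(L/K)) = Nat.card (P.inertia Gal(L/ℚ)) := by
      have h2 : (P.inertia Gal(L/K)).map (AlgEquiv.restrictScalarsHom ℚ) =
          ((AlgEquiv.restrictNormalHom (F := ℚ) K).ker.subgroupOf (P.inertia Gal(L/ℚ))).map
            (P.inertia Gal(L/ℚ)).subtype := by
        rw [Subgroup.subgroupOf_map_subtype]
        ext σ
        constructor
        · rintro ⟨τ, hτ, rfl⟩
          refine ⟨?_, hτ⟩
          ext x
          apply (algebraMap K L).injective
          exact (AlgEquiv.restrictNormal_commutes (τ.restrictScalars ℚ) K x).trans (τ.commutes x)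
        · rintro ⟨hσ, hσP⟩
          refine ⟨AlgEquiv.ofRingEquiv (f := σ.toRingEquiv) fun x ↦ ?_, hσP, rfl⟩
          have := AlgEquiv.restrictNormal_commutes σ K x
          have h3 : σ.restrictNormal K = 1 := hσ
          rw [h3] at this
          exact this.symm
      rw [← Subgroup.relIndex_ker, mul_comm, Subgroup.relIndex,
        ← Subgroup.card_mul_index ((AlgEquiv.restrictNormalHom (F := ℚ) K).ker.subgroupOf _),
        ← Subgroup.card_map_of_injective (Subgroup.subtype_injective (P.inertia Gal(L/ℚ))), ← h2,
        Subgroup.card_map_of_injective (AlgEquiv.restrictScalars_injective ℚ)]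
    rw [Ideal.card_inertia_eq_ramificationIdx (R := ℤ) (G := Gal(L/ℚ)),
      Ideal.ramificationIdx_tower (R := ℤ) (P.under (𝓞 K)) P,
      Ideal.card_inertia_eq_ramificationIdx (R := 𝓞 K) (G := Gal(L/K)),
      ← Ideal.card_inertia_eq_ramificationIdx (R := ℤ) (G := Gal(K/ℚ))] at h1
    exact (Nat.eq_of_mul_eq_mul_right (Ideal.ramificationIdx_pos ..) h1).ge

end InertiaCard

section Discriminant

open scoped Pointwise nonZeroDivisors

variable {K : Type*} [Field K] [NumberField K]

theorem NumberField.differentIdeal_le_iff_trace {I : Ideal (𝓞 K)} (hI : I ≠ ⊥) :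
    differentIdeal ℤ (𝓞 K) ≤ I ↔ ∀ x : K, (∀ y ∈ I, ∃ z : 𝓞 K, (z : K) = x * y) →
      ∃ k : ℤ, (k : ℚ) = Algebra.trace ℚ K x := by
  have hI' : (I : FractionalIdeal (𝓞 K)⁰ K) ≠ 0 := by simpa using hI
  rw [differentialIdeal_le_iff (K := ℚ) (L := K) hI, Submodule.map_le_iff_le_comap]
  refine forall_congr' fun x ↦ ?_
  have h1 : x ∈ (((I : FractionalIdeal (𝓞 K)⁰ K)⁻¹ : FractionalIdeal (𝓞 K)⁰ K) :
      Submodule (𝓞 K) K).restrictScalars ℤ ↔ ∀ y ∈ I, ∃ z : 𝓞 K, (z : K) = x * y := by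
    rw [Submodule.restrictScalars_mem, FractionalIdeal.mem_coe, FractionalIdeal.mem_inv_iff hI']
    simp [FractionalIdeal.mem_one_iff]
  rw [h1, Submodule.mem_comap, Submodule.mem_one]
  rfl

theorem NumberField.differentIdeal_le_smul {I : Ideal (𝓞 K)} (hI : I ≠ ⊥)
    (h : differentIdeal ℤ (𝓞 K) ≤ I) (σ : Gal(K/ℚ)) : differentIdeal ℤ (𝓞 K) ≤ σ • I := by
  have hσI : σ • I ≠ ⊥ := by
    intro h0
    apply hI
    rw [← inv_smul_smul σ I, h0, Ideal.smul_bot]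
  rw [differentIdeal_le_iff_trace hσI]
  rw [differentIdeal_le_iff_trace hI] at h
  intro x hx
  obtain ⟨k, hk⟩ := h (σ.symm x) fun y hy ↦ by
    obtain ⟨z, hz⟩ := hx (σ • y) (Ideal.smul_mem_pointwise_smul _ _ _ hy)
    refine ⟨σ⁻¹ • z, ?_⟩
    change σ.symm (z : K) = _
    rw [hz, map_mul]
    congr 1
    exact σ.symm_apply_apply y
  exact ⟨k, hk.trans (Algebra.trace_eq_of_algEquiv σ.symm x)⟩

theorem NumberField.exists_isPrime_mem (K : Type*) [Field K] [NumberField K] {p : ℕ}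
    (hp : p.Prime) : ∃ P : Ideal (𝓞 K), P.IsPrime ∧ (p : 𝓞 K) ∈ P := by
  have hspan : Ideal.span {(p : 𝓞 K)} ≠ ⊤ := by
    intro h
    have h1 := congrArg Ideal.absNorm h
    rw [Ideal.absNorm_span_natCast, Ideal.absNorm_top, Nat.pow_eq_one] at h1
    exact h1.elim hp.ne_one Module.finrank_pos.ne'
  obtain ⟨P, hP, hle⟩ := Ideal.exists_le_maximal _ hspan
  exact ⟨P, hP.isPrime, hle (Ideal.mem_span_singleton_self _)⟩

theorem NumberField.exists_smul_eq_of_mem [IsGalois ℚ K] {p : ℕ} (hp : p.Prime) {P Q : Ideal (𝓞 K)}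
    [P.IsPrime] [Q.IsPrime] (hP : (p : 𝓞 K) ∈ P) (hQ : (p : 𝓞 K) ∈ Q) :
    ∃ σ : Gal(K/ℚ), σ • P = Q := by
  have := liesOver_span_of_mem hp hP
  have := liesOver_span_of_mem hp hQ
  exact Ideal.exists_smul_eq_of_isGaloisGroup (Ideal.span {(p : ℤ)}) P Q Gal(K/ℚ)

theorem NumberField.card_inertia_eq_of_mem [IsGalois ℚ K] {p : ℕ} (hp : p.Prime)
    {P Q : Ideal (𝓞 K)} [P.IsPrime] [Q.IsPrime] (hP : (p : 𝓞 K) ∈ P) (hQ : (p : 𝓞 K) ∈ Q) :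
    Nat.card (P.inertia Gal(K/ℚ)) = Nat.card (Q.inertia Gal(K/ℚ)) := by
  have hP0 : P ≠ ⊥ := by
    rintro rfl
    exact hp.ne_zero (by simpa using hP)
  have hQ0 : Q ≠ ⊥ := by
    rintro rfl
    exact hp.ne_zero (by simpa using hQ)
  have := finite_quotient_under_int hP0
  have := finite_quotient_under_int hQ0
  obtain ⟨σ, rfl⟩ := exists_smul_eq_of_mem hp hP hQ
  rw [Ideal.card_inertia_eq_ramificationIdx (R := ℤ),
    Ideal.card_inertia_eq_ramificationIdx (R := ℤ), Ideal.ramificationIdx_smul]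

theorem NumberField.emultiplicity_span_natCast [IsGalois ℚ K] {p : ℕ} (hp : p.Prime)
    {P : Ideal (𝓞 K)} [P.IsPrime] (hP : (p : 𝓞 K) ∈ P) :
    emultiplicity P (Ideal.span {(p : 𝓞 K)}) = Nat.card (P.inertia Gal(K/ℚ)) := by
  have hmap : (Ideal.span {(p : ℤ)}).map (algebraMap ℤ (𝓞 K)) = Ideal.span {(p : 𝓞 K)} := by
    simp [Ideal.map_span]
  have h0 : Ideal.span {(p : 𝓞 K)} ≠ ⊥ := by simpa using hp.ne_zero
  have hP0 : P ≠ ⊥ := by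
    rintro rfl
    exact hp.ne_zero (by simpa using hP)
  have := liesOver_span_of_mem hp hP
  have := finite_quotient_under_int hP0
  rw [Ideal.card_inertia_eq_ramificationIdx (R := ℤ),
    Ideal.IsDedekindDomain.ramificationIdx_eq_multiplicity (Ideal.span {(p : ℤ)}) P (by rwa [hmap]),
    hmap]
  refine FiniteMultiplicity.emultiplicity_eq_multiplicity (FiniteMultiplicity.of_not_isUnit ?_ h0)
  exact fun h ↦ Ideal.IsPrime.ne_top ‹_› (Ideal.isUnit_iff.mp h)

theorem NumberField.span_natCast_pow_dvd_of_forall [IsGalois ℚ K] {p : ℕ} (hp : p.Prime)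
    {e k l : ℕ} {I : Ideal (𝓞 K)}
    (he : ∀ P : Ideal (𝓞 K), P.IsPrime → (p : 𝓞 K) ∈ P → Nat.card (P.inertia Gal(K/ℚ)) = e)
    (h : ∀ P : Ideal (𝓞 K), P.IsPrime → (p : 𝓞 K) ∈ P → P ^ k ∣ I) (hl : e * l ≤ k) :
    Ideal.span {(p : 𝓞 K)} ^ l ∣ I := by
  have h0 : Ideal.span {(p : 𝓞 K)} ≠ ⊥ := by simpa using hp.ne_zero
  rw [UniqueFactorizationMonoid.dvd_iff_emultiplicity_le (pow_ne_zero _ h0)]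
  intro P hP
  have hPp := Ideal.isPrime_of_prime hP
  rw [emultiplicity_pow hP]
  by_cases hpP : (p : 𝓞 K) ∈ P
  · rw [emultiplicity_span_natCast hp hpP, he P hPp hpP]
    refine le_trans ?_ (le_emultiplicity_of_pow_dvd (h P hPp hpP))
    rw [mul_comm]
    exact_mod_cast hl
  · rw [emultiplicity_eq_zero.mpr]
    · simp
    · rwa [Ideal.dvd_iff_le, Ideal.span_singleton_le_iff_mem]

theorem NumberField.prime_pow_dvd_natAbs_discr [IsGalois ℚ K] {p : ℕ} (hp : p.Prime)
    {P : Ideal (𝓞 K)} [P.IsPrime] (hP : (p : 𝓞 K) ∈ P) :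
    p ^ (Module.finrank ℚ K - Module.finrank ℚ K / Nat.card (P.inertia Gal(K/ℚ))) ∣
      (discr K).natAbs := by
  set e := Nat.card (P.inertia Gal(K/ℚ)) with he
  have he0 : e ≠ 0 := Nat.card_pos.ne'
  have hen : e ∣ Module.finrank ℚ K := by
    rw [← IsGalois.card_aut_eq_finrank]
    exact Subgroup.card_subgroup_dvd_card _
  obtain ⟨k, hk⟩ := hen
  have hp0 : Ideal.span {(p : ℤ)} ≠ ⊥ := by simpa using hp.ne_zero
  have : (Ideal.span {(p : ℤ)}).IsMaximal :=
    PrincipalIdealRing.isMaximal_of_irreducible (Nat.prime_iff_prime_int.mp hp).irreducible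
  have hdvd : Ideal.span {(p : 𝓞 K)} ^ (e - 1) ∣ differentIdeal ℤ (𝓞 K) ^ e := by
    refine span_natCast_pow_dvd_of_forall hp (e := e) (k := (e - 1) * e) (fun Q _ hQ ↦ ?_)
      (fun Q _ hQ ↦ ?_) (mul_comm _ _).le
    · exact (card_inertia_eq_of_mem hp hQ hP).trans he.symm
    · rw [pow_mul]
      refine pow_dvd_pow_of_dvd (pow_sub_one_dvd_differentIdeal ℤ Q e hp0 ?_) e
      have hmap : (Ideal.span {(p : ℤ)}).map (algebraMap ℤ (𝓞 K)) = Ideal.span {(p : 𝓞 K)} := by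
        simp [Ideal.map_span]
      rw [hmap]
      refine pow_dvd_of_le_emultiplicity ?_
      rw [emultiplicity_span_natCast hp hQ, card_inertia_eq_of_mem hp hQ hP]
  have hnorm := Ideal.absNorm_dvd_absNorm_of_le (Ideal.dvd_iff_le.mp hdvd)
  rw [map_pow, map_pow, Ideal.absNorm_span_natCast, RingOfIntegers.rank, hk,
    absNorm_differentIdeal K, ← pow_mul, mul_assoc, mul_comm e, pow_mul,
    Nat.pow_dvd_pow_iff he0] at hnorm
  convert hnorm using 2
  rw [hk, Nat.mul_div_cancel_left _ (Nat.pos_of_ne_zero he0), Nat.mul_sub, mul_one, mul_comm]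

theorem NumberField.not_differentIdeal_le_span_natCast {d : ℕ} (hd : d ≠ 0)
    (hn : ¬ d ∣ Module.finrank ℚ K) : ¬ differentIdeal ℤ (𝓞 K) ≤ Ideal.span {(d : 𝓞 K)} := by
  intro h
  rw [differentIdeal_le_iff_trace (by simpa using hd)] at h
  obtain ⟨k, hk⟩ := h (algebraMap ℚ K (d : ℚ)⁻¹) fun y hy ↦ by
    obtain ⟨z, rfl⟩ := Ideal.mem_span_singleton.mp hy
    refine ⟨z, ?_⟩
    have : (d : K) ≠ 0 := by exact_mod_cast hd
    simp [this]
  rw [Algebra.trace_algebraMap] at hk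
  have hd' : (d : ℚ) ≠ 0 := by exact_mod_cast hd
  have : ((d : ℤ) * k : ℚ) = (Module.finrank ℚ K : ℤ) := by
    rw [hk]
    simp
    field_simp
  exact hn (Int.natCast_dvd_natCast.mp ⟨k, by exact_mod_cast this.symm⟩)

theorem NumberField.natAbs_discr_le_of_inertia_eq_bot [IsGalois ℚ K] {m : ℕ} (hm : m ≠ 0)
    (hK : Module.finrank ℚ K ∣ m)
    (h : ∀ p : ℕ, p.Prime → ¬ p ∣ m → ∀ P : Ideal (𝓞 K), P.IsPrime → (p : 𝓞 K) ∈ P →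
      P.inertia Gal(K/ℚ) = ⊥) : (discr K).natAbs ≤ (m * m) ^ m := by
  set n := Module.finrank ℚ K with hn
  have hn0 : n ≠ 0 := Module.finrank_pos.ne'
  have hD0 : differentIdeal ℤ (𝓞 K) ≠ ⊥ := differentIdeal_ne_bot
  have hdvd : differentIdeal ℤ (𝓞 K) ∣ Ideal.span {((n * m : ℕ) : 𝓞 K)} := by
    rw [UniqueFactorizationMonoid.dvd_iff_emultiplicity_le hD0]
    intro P hP
    have hPp := Ideal.isPrime_of_prime hP
    have hP0 : P ≠ ⊥ := hP.ne_zero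
    obtain ⟨p, hp, hpP⟩ : ∃ p : ℕ, p.Prime ∧ (p : 𝓞 K) ∈ P := by
      have : NeZero P := ⟨hP0⟩
      refine ⟨Ideal.absNorm (P.under ℤ), Nat.absNorm_under_prime P, ?_⟩
      simpa using Int.absNorm_under_mem P
    set e := Nat.card (P.inertia Gal(K/ℚ)) with he
    obtain ⟨a, ha, hna⟩ : ∃ a, p ^ a ∣ n ∧ ¬ p ^ (a + 1) ∣ n := by
      have := Nat.finiteMultiplicity_iff.mpr ⟨hp.ne_one, Nat.pos_of_ne_zero hn0⟩
      exact ⟨_, pow_multiplicity_dvd p n, this.not_pow_dvd_of_multiplicity_lt (Nat.lt_succ_self _)⟩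
    have hlt : ¬ P ^ (e * (a + 1)) ∣ differentIdeal ℤ (𝓞 K) := by
      intro hdvd
      refine not_differentIdeal_le_span_natCast (K := K) (pow_ne_zero (a + 1) hp.ne_zero) hna ?_
      rw [Nat.cast_pow, ← Ideal.span_singleton_pow, ← Ideal.dvd_iff_le]
      refine span_natCast_pow_dvd_of_forall hp (e := e) (fun Q _ hQ ↦ ?_) (fun Q _ hQ ↦ ?_) le_rfl
      · exact card_inertia_eq_of_mem hp hQ hpP
      · obtain ⟨σ, rfl⟩ := exists_smul_eq_of_mem hp hpP hQ
        rw [← smul_pow']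
        exact Ideal.dvd_iff_le.mpr (differentIdeal_le_smul (pow_ne_zero _ hP0)
          (Ideal.dvd_iff_le.mp hdvd) σ)
    have hlt := emultiplicity_lt_iff_not_dvd.mpr hlt
    by_cases hpm : p ∣ m
    · refine hlt.le.trans (le_emultiplicity_of_pow_dvd ?_)
      rw [pow_mul]
      have h1 : P ^ e ∣ Ideal.span {(p : 𝓞 K)} :=
        pow_dvd_of_le_emultiplicity (emultiplicity_span_natCast hp hpP).ge
      refine (pow_dvd_pow_of_dvd h1 _).trans ?_
      rw [Ideal.span_singleton_pow, Ideal.dvd_iff_le, Ideal.span_singleton_le_span_singleton]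
      exact_mod_cast Nat.cast_dvd_cast (mul_dvd_mul ha hpm)
    · have he1 : e = 1 := by
        rw [he, h p hp hpm P hPp hpP]
        simp
      have ha0 : a = 0 := by
        by_contra h0
        exact hpm (((dvd_pow_self p h0).trans ha).trans hK)
      rw [he1, ha0] at hlt
      have : emultiplicity P (differentIdeal ℤ (𝓞 K)) = 0 := by
        simpa using hlt
      rw [this]
      exact zero_le
  have hnorm := Ideal.absNorm_dvd_absNorm_of_le (Ideal.dvd_iff_le.mp hdvd)
  rw [Ideal.absNorm_span_natCast, RingOfIntegers.rank, absNorm_differentIdeal K, ← hn] at hnorm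
  refine (Nat.le_of_dvd (by positivity) hnorm).trans ?_
  have hnm : n ≤ m := Nat.le_of_dvd (Nat.pos_of_ne_zero hm) hK
  calc (n * m) ^ n ≤ (m * m) ^ n := by gcongr
    _ ≤ (m * m) ^ m := Nat.pow_le_pow_right (by positivity) hnm

end Discriminant

section GaloisTheory

variable {k Ω : Type*} [Field k] [Field Ω] [Algebra k Ω]

theorem IntermediateField.fixingSubgroup_injective [IsGalois k Ω] :
    Function.Injective (IntermediateField.fixingSubgroup (F := k) (E := Ω)) :=
  Function.LeftInverse.injective fun L ↦ InfiniteGalois.fixedField_fixingSubgroup L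

/-- A normal subgroup containing `Gal(Ω/M)` is of the form `Gal(Ω/K)` with `K ≤ M` Galois. -/
theorem IntermediateField.exists_fixingSubgroup_eq [IsGalois k Ω] (M : IntermediateField k Ω)
    [FiniteDimensional k M] (N : Subgroup Gal(Ω/k)) [N.Normal] (h : M.fixingSubgroup ≤ N) :
    ∃ K : IntermediateField k Ω, K ≤ M ∧ K.fixingSubgroup = N ∧ IsGalois k K ∧
      FiniteDimensional k K := by
  have hopen : IsOpen (N : Set Gal(Ω/k)) :=
    Subgroup.isOpen_mono h M.fixingSubgroup_isOpen
  let N' : ClosedSubgroup Gal(Ω/k) := ⟨N, N.isClosed_of_isOpen hopen⟩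
  have hN : (fixedField N).fixingSubgroup = N := InfiniteGalois.fixingSubgroup_fixedField N'
  have hKM : fixedField N ≤ M := by
    rw [← InfiniteGalois.fixedField_fixingSubgroup M]
    exact fixedField_antitone h
  refine ⟨fixedField N, hKM, hN, ?_, ?_⟩
  · rw [← InfiniteGalois.normal_iff_isGalois, hN]
    infer_instance
  · exact FiniteDimensional.of_injective (inclusion hKM).toLinearMap (inclusion hKM).injective

theorem IntermediateField.fixingSubgroup_iSup {ι : Sort*} (L : ι → IntermediateField k Ω) :
    (⨆ i, L i).fixingSubgroup = ⨅ i, (L i).fixingSubgroup := by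
  refine eq_of_forall_le_iff fun H ↦ ?_
  rw [← IntermediateField.le_iff_le, iSup_le_iff, le_iInf_iff]
  exact forall_congr' fun i ↦ IntermediateField.le_iff_le _ _

end GaloisTheory

open scoped Pointwise in
theorem Ideal.inertia_smul_of_commute {R G : Type*} [CommRing R] [Group G] [MulSemiringAction G R]
    {P : Ideal R} {σ : G} (h : ∀ g, Commute g σ) : (σ • P).inertia G = P.inertia G := by
  ext g
  have h1 : ∀ x : R, g • x - x ∈ σ • P ↔ g • σ⁻¹ • x - σ⁻¹ • x ∈ P := fun x ↦ by
    rw [Ideal.mem_pointwise_smul_iff_inv_smul_mem, smul_sub, smul_smul, smul_smul,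
      (h g).inv_right.eq]
  exact (forall_congr' h1).trans ((MulAction.surjective σ⁻¹).forall (p := fun x ↦
    g • x - x ∈ P)).symm

section AlgebraicClosureRat

instance AlgebraicClosure.isGalois_rat : IsGalois ℚ Qbar :=
  @IsAlgClosure.isGalois ℚ Qbar _ _ (AlgebraicClosure.instAlgebra ℚ)
    ((inferInstance : @IsAlgClosure ℚ Qbar _ _ (AlgebraicClosure.instAlgebra ℚ) _)) _

theorem IntermediateField.isGalois_rat_iff (L : IntermediateField ℚ Qbar) :
    IsGalois ℚ L ↔ @IsGalois ℚ _ L _ L.algebra' := Iff.rfl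

theorem IntermediateField.finiteDimensional_rat_iff (L : IntermediateField ℚ Qbar) :
    FiniteDimensional ℚ L ↔ @Module.Finite ℚ L _ _ L.algebra'.toModule := Iff.rfl

theorem IntermediateField.ker_restrictNormalHom_rat (L : IntermediateField ℚ Qbar)
    [h : IsGalois ℚ L] : (AlgEquiv.restrictNormalHom (F := ℚ) (K₁ := Qbar) L).ker = L.fixingSubgroup :=
  have := L.isGalois_rat_iff.mp h
  IntermediateField.restrictNormalHom_ker L

theorem IntermediateField.finrank_rat_eq_index (L : IntermediateField ℚ Qbar) :
    Module.finrank ℚ L = L.fixingSubgroup.index :=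
  IntermediateField.finrank_eq_fixingSubgroup_index Qbar L

theorem IntermediateField.exists_fixingSubgroup_eq_rat (M : IntermediateField ℚ Qbar)
    [h : FiniteDimensional ℚ M] (N : Subgroup Gal(Qbar/ℚ)) [N.Normal] (h : M.fixingSubgroup ≤ N) :
    ∃ K : IntermediateField ℚ Qbar, K ≤ M ∧ K.fixingSubgroup = N ∧ IsGalois ℚ K ∧
      FiniteDimensional ℚ K :=
  have := M.finiteDimensional_rat_iff.mp ‹_›
  M.exists_fixingSubgroup_eq N h

/-- The restriction of `τ` to every finite Galois subfield of `M` generates all the inertia groups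
at the primes above `p`. -/
def IsInertiaGenerator (M : IntermediateField ℚ Qbar) (p : ℕ) (τ : Gal(Qbar/ℚ)) : Prop :=
  ∀ (L : IntermediateField ℚ Qbar) [FiniteDimensional ℚ L] [IsGalois ℚ L], L ≤ M →
    ∀ P : Ideal (𝓞 L), P.IsPrime → (p : 𝓞 L) ∈ P →
      P.inertia Gal(L/ℚ) = Subgroup.zpowers (AlgEquiv.restrictNormalHom L τ)

/-- If `Gal(M/ℚ)` is abelian of exponent dividing `m`, then for every prime `p ∤ m` there is a
single automorphism generating the inertia groups at `p` of all Galois subfields of `M`. -/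
theorem IntermediateField.exists_isInertiaGenerator (M : IntermediateField ℚ Qbar)
    [FiniteDimensional ℚ M] [IsGalois ℚ M] {m : ℕ}
    (hcomm : ∀ σ τ : Gal(Qbar/ℚ), σ * τ * σ⁻¹ * τ⁻¹ ∈ M.fixingSubgroup)
    (hpow : ∀ σ : Gal(Qbar/ℚ), σ ^ m ∈ M.fixingSubgroup) {p : ℕ} (hp : p.Prime) (hpm : ¬ p ∣ m) :
    ∃ τ : Gal(Qbar/ℚ), IsInertiaGenerator M p τ := by
  have : NumberField M := ⟨⟩
  let r : Gal(Qbar/ℚ) →* Gal(M/ℚ) := AlgEquiv.restrictNormalHom M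
  have hr : Function.Surjective r := AlgEquiv.restrictNormalHom_surjective Qbar
  have hker : r.ker = M.fixingSubgroup := M.ker_restrictNormalHom_rat
  obtain ⟨P₀, hP₀, hpP₀⟩ := NumberField.exists_isPrime_mem M hp
  have hP₀0 : P₀ ≠ ⊥ := by
    rintro rfl
    exact hp.ne_zero (by simpa using hpP₀)
  have hmP₀ : (m : 𝓞 M) ∉ P₀ := by
    intro hmP
    have h1 : (1 : 𝓞 M) ∈ P₀ := by
      obtain ⟨u, v, huv⟩ := Nat.isCoprime_iff_coprime.mpr
        ((Nat.Prime.coprime_iff_not_dvd hp).mpr hpm)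
      have := congrArg (Int.cast : ℤ → 𝓞 M) huv
      push_cast at this
      rw [← this]
      exact P₀.add_mem (P₀.mul_mem_left _ hpP₀) (P₀.mul_mem_left _ hmP)
    exact Ideal.IsPrime.ne_top ‹_› ((Ideal.eq_top_iff_one _).mpr h1)
  have : FaithfulSMul Gal(M/ℚ) (𝓞 M) := IsGaloisGroup.faithful ℤ
  have hcyc : IsCyclic (P₀.inertia Gal(M/ℚ)) := by
    refine Ideal.isCyclic_inertia_of_pow_eq_one hP₀0 (m := m) (fun σ _ ↦ ?_) hmP₀
    obtain ⟨σ, rfl⟩ := hr σ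
    rw [← map_pow, ← MonoidHom.mem_ker, hker]
    exact hpow σ
  obtain ⟨g, hg⟩ := (Subgroup.isCyclic_iff_exists_zpowers_eq_top _).mp hcyc
  obtain ⟨τ, rfl⟩ := hr g
  refine ⟨τ, fun L _ _ hLM P hP hpP ↦ ?_⟩
  have : NumberField L := ⟨⟩
  let : Algebra L M := (IntermediateField.inclusion hLM).toAlgebra
  have : IsScalarTower L M Qbar := IsScalarTower.of_algebraMap_eq fun _ ↦ rfl
  have hP₀L : (P₀.under (𝓞 L)).inertia Gal(L/ℚ) =
      Subgroup.zpowers (AlgEquiv.restrictNormalHom L τ) := by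
    rw [← NumberField.map_inertia_restrictNormalHom hP₀0, ← hg, MonoidHom.map_zpowers,
      ← IsScalarTower.AlgEquiv.restrictNormalHom_comp_apply L M τ]
  obtain ⟨σ, rfl⟩ := NumberField.exists_smul_eq_of_mem hp (P := P₀.under (𝓞 L)) (Q := P)
    (by simpa using hpP₀) hpP
  rw [← hP₀L]
  refine Ideal.inertia_smul_of_commute fun g ↦ ?_
  obtain ⟨σ, rfl⟩ := AlgEquiv.restrictNormalHom_surjective (F := ℚ) (K₁ := L) Qbar σ
  obtain ⟨g, rfl⟩ := AlgEquiv.restrictNormalHom_surjective (F := ℚ) (K₁ := L) Qbar g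
  have h1 : g * σ * g⁻¹ * σ⁻¹ ∈ (AlgEquiv.restrictNormalHom (F := ℚ) (K₁ := Qbar) L).ker := by
    rw [L.ker_restrictNormalHom_rat]
    exact IntermediateField.fixingSubgroup_antitone hLM (hcomm g σ)
  rwa [MonoidHom.mem_ker, map_mul, map_mul, map_mul, map_inv, map_inv, mul_inv_eq_one,
    mul_inv_eq_iff_eq_mul] at h1

end AlgebraicClosureRat

section AExtension

variable {A : Type*} [CommGroup A]

/-- The surjection `Gal(Qbar/ℚ) → A` attached to an `A`-extension. -/
def AExtension.toHom (E : AExtension A) : Gal(Qbar/ℚ) →* A :=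
  have := E.gal
  E.ψ.toMonoidHom.comp (AlgEquiv.restrictNormalHom E.L)

theorem AExtension.ker_toHom (E : AExtension A) : E.toHom.ker = E.L.fixingSubgroup := by
  have := E.gal
  rw [← E.L.ker_restrictNormalHom_rat]
  exact MonoidHom.ker_mulEquiv_comp _ E.ψ

theorem AExtension.toHom_injective :
    Function.Injective (AExtension.toHom : AExtension A → Gal(Qbar/ℚ) →* A) := by
  intro E E' h
  have hL : E.L = E'.L := by
    apply IntermediateField.fixingSubgroup_injective
    rw [← E.ker_toHom, ← E'.ker_toHom, h]
  obtain ⟨L, fd, gal, ψ⟩ := E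
  obtain ⟨L', fd', gal', ψ'⟩ := E'
  subst hL
  congr
  ext σ
  obtain ⟨σ, rfl⟩ := AlgEquiv.restrictNormalHom_surjective (F := ℚ) (K₁ := L) Qbar σ
  exact DFunLike.congr_fun h σ

theorem AExtension.finrank_eq (E : AExtension A) : Module.finrank ℚ E.L = Nat.card A := by
  have := E.gal
  have := E.fd
  rw [← Nat.card_congr E.ψ.toEquiv, IsGalois.card_aut_eq_finrank]

theorem absDisc_eq (L : IntermediateField ℚ Qbar) [NumberField L] :
    absDisc L = (NumberField.discr L).natAbs := by
  have : FiniteDimensional ℚ L := NumberField.to_finiteDimensional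
  rw [absDisc, dif_pos this]

theorem absDisc_pos (L : IntermediateField ℚ Qbar) [h : FiniteDimensional ℚ L] : 0 < absDisc L := by
  have : NumberField L := ⟨⟩
  rw [absDisc_eq]
  exact Int.natAbs_pos.mpr (NumberField.discr_ne_zero L)

theorem pow_ind_dvd_absDisc [Fintype A] {E : AExtension A} {M : IntermediateField ℚ Qbar} {p : ℕ}
    {τ : Gal(Qbar/ℚ)} (hτ : IsInertiaGenerator M p τ) (hE : E.L ≤ M) (hp : p.Prime) :
    p ^ ind A (E.toHom τ) ∣ absDisc E.L := by
  have := E.gal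
  have := E.fd
  have : NumberField E.L := ⟨⟩
  obtain ⟨P, hP, hpP⟩ := NumberField.exists_isPrime_mem E.L hp
  have h := NumberField.prime_pow_dvd_natAbs_discr hp hpP
  rw [hτ E.L hE P hP hpP, Nat.card_zpowers, E.finrank_eq] at h
  have h1 : orderOf (E.toHom τ) = orderOf (AlgEquiv.restrictNormalHom E.L τ) :=
    orderOf_injective E.ψ.toMonoidHom E.ψ.injective _
  rwa [ind, absDisc_eq, h1, Fintype.card_eq_nat_card]

theorem SatisfiesSpec.zpowers_eq {E : AExtension A} {Λ : Finset ℕ} {b : ℕ → A}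
    (h : SatisfiesSpec E Λ b) {p : ℕ} (hp : p ∈ Λ)
    {M : IntermediateField ℚ Qbar} {τ : Gal(Qbar/ℚ)} (hτ : IsInertiaGenerator M p τ)
    (hE : E.L ≤ M) :
    Subgroup.zpowers (E.toHom τ) = Subgroup.zpowers (b p) := by
  have := E.gal
  have := E.fd
  obtain ⟨P, hP, hpP, hσ⟩ := h p hp
  have h1 : P.inertia Gal(E.L/ℚ) = (Subgroup.zpowers (b p)).comap E.ψ.toMonoidHom := by
    ext σ
    rw [Subgroup.mem_comap]
    refine Iff.trans (forall_congr' fun x ↦ ?_) (hσ σ)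
    constructor
    · exact fun h ↦ ⟨_, h, rfl⟩
    · rintro ⟨y, hy, hyx⟩
      have : σ • x - x = y := NumberField.RingOfIntegers.ext hyx.symm
      change σ • x - x ∈ P
      rwa [this]
  rw [hτ E.L hE P hP hpP] at h1
  have h2 := Subgroup.map_comap_eq_self_of_surjective (f := E.ψ.toMonoidHom)
    E.ψ.surjective (Subgroup.zpowers (b p))
  exact (MonoidHom.map_zpowers E.ψ.toMonoidHom _).symm.trans ((congrArg _ h1).trans h2)

theorem ind_eq_of_zpowers_eq [Fintype A] {g h : A}
    (hgh : Subgroup.zpowers g = Subgroup.zpowers h) : ind A g = ind A h := by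
  rw [ind, ind, ← Nat.card_zpowers g, hgh, Nat.card_zpowers]

theorem minInd_le_ind [Fintype A] {g : A} (hg : g ≠ 1) : minInd A ≤ ind A g :=
  Nat.sInf_le ⟨g, hg, rfl⟩

theorem minInd_pos [Fintype A] [Nontrivial A] : 0 < minInd A := by
  obtain ⟨g, hg⟩ := exists_ne (1 : A)
  obtain ⟨g, hg, hgm⟩ := Nat.sInf_mem (s := {n | ∃ g : A, g ≠ 1 ∧ ind A g = n}) ⟨_, g, hg, rfl⟩
  rw [minInd, ← hgm, ind, Nat.sub_pos_iff_lt]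
  refine Nat.div_lt_self Fintype.card_pos ?_
  have := orderOf_pos g
  have := mt orderOf_eq_one_iff.mp hg
  lia

end AExtension

section Finiteness

theorem MonoidHom.finite_setOf_le_ker {G A : Type*} [Group G] [Group A] [Finite A] (H : Subgroup G)
    [H.FiniteIndex] : {χ : G →* A | H ≤ χ.ker}.Finite := by
  refine Set.Finite.of_finite_image (f := fun χ (q : G ⧸ H) ↦ χ q.out) (Set.toFinite _) ?_
  intro χ hχ χ' hχ' h
  ext σ
  have h1 := QuotientGroup.mk_out_eq_mul H σ
  obtain ⟨η, hη⟩ := h1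
  have h2 : χ (σ * η) = χ' (σ * η) := by
    rw [← hη]
    exact congrFun h _
  rwa [map_mul, map_mul, hχ η.2, hχ' η.2, mul_one, mul_one] at h2

theorem IsInertiaGenerator.mem_fixingSubgroup {M : IntermediateField ℚ Qbar}
    [FiniteDimensional ℚ M] [IsGalois ℚ M] {p : ℕ} {τ : Gal(Qbar/ℚ)}
    (hτ : IsInertiaGenerator M p τ) (hp : p.Prime) (hM : ¬ p ∣ absDisc M) :
    τ ∈ M.fixingSubgroup := by
  have : NumberField M := ⟨⟩
  obtain ⟨P, hP, hpP⟩ := NumberField.exists_isPrime_mem M hp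
  have h := NumberField.prime_pow_dvd_natAbs_discr hp hpP
  rw [← absDisc_eq] at h
  have hτP := hτ M le_rfl P hP hpP
  have h0 : Module.finrank ℚ M - Module.finrank ℚ M / Nat.card (P.inertia Gal(M/ℚ)) = 0 := by
    by_contra h0
    exact hM ((dvd_pow_self p h0).trans h)
  have hcard : Nat.card (P.inertia Gal(M/ℚ)) ≤ 1 := by
    by_contra! h1
    exact (Nat.sub_pos_of_lt (Nat.div_lt_self (Module.finrank_pos (R := ℚ) (M := M)) h1)).ne' h0
  have hbot := Subgroup.eq_bot_of_card_le _ hcard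
  rwa [hτP, Subgroup.zpowers_eq_bot, ← MonoidHom.mem_ker, M.ker_restrictNormalHom_rat] at hbot

/-- For a finite group `A` there are only finitely many homomorphisms `Gal(Qbar/ℚ) → A` with
abelian image that are unramified at all primes not dividing `|A|`. -/
theorem exists_finite_forall_mem_of_isInertiaGenerator (A : Type*) [CommGroup A] [Finite A] :
    ∃ X : Set (Gal(Qbar/ℚ) →* A), X.Finite ∧ ∀ (χ : Gal(Qbar/ℚ) →* A)
      (M : IntermediateField ℚ Qbar) [FiniteDimensional ℚ M], M.fixingSubgroup ≤ χ.ker →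
      (∀ p : ℕ, p.Prime → ¬ p ∣ Nat.card A → ∃ τ, IsInertiaGenerator M p τ ∧ χ τ = 1) → χ ∈ X := by
  set m := Nat.card A with hm
  have hm0 : m ≠ 0 := Nat.card_pos.ne'
  let S := {K : {F : IntermediateField ℚ Qbar // FiniteDimensional ℚ F} |
    haveI : NumberField K := @NumberField.mk _ _ inferInstance K.prop
    |NumberField.discr K| ≤ ((m * m) ^ m : ℕ)}
  have hS : S.Finite := NumberField.finite_of_discr_bdd Qbar _
  have : Finite S := hS
  let W : IntermediateField ℚ Qbar := ⨆ K : S, K.1.1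
  have hW : FiniteDimensional ℚ W :=
    have : ∀ K : S, @Module.Finite ℚ K.1.1 _ _ K.1.1.algebra'.toModule := fun K ↦ K.1.2
    IntermediateField.finiteDimensional_iSup_of_finite (t := fun K : S ↦ K.1.1)
  have : W.fixingSubgroup.FiniteIndex := by
    refine ⟨?_⟩
    rw [← W.finrank_rat_eq_index]
    exact Module.finrank_pos.ne'
  refine ⟨_, MonoidHom.finite_setOf_le_ker W.fixingSubgroup, fun χ M _ hχ hτ ↦ ?_⟩
  obtain ⟨K, hKM, hK, hgal, hfd⟩ := M.exists_fixingSubgroup_eq_rat χ.ker hχ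
  have : NumberField K := ⟨⟩
  have hdisc : (NumberField.discr K).natAbs ≤ (m * m) ^ m := by
    refine NumberField.natAbs_discr_le_of_inertia_eq_bot hm0 ?_ fun p hp hpm P hP hpP ↦ ?_
    · rw [K.finrank_rat_eq_index, hK, Subgroup.index_ker]
      exact Subgroup.card_subgroup_dvd_card _
    · obtain ⟨τ, hτ, hχτ⟩ := hτ p hp hpm
      rw [hτ K hKM P hP hpP, Subgroup.zpowers_eq_bot, ← MonoidHom.mem_ker,
        K.ker_restrictNormalHom_rat, hK]
      exact hχτ
  have hKS : (⟨K, hfd⟩ : {F : IntermediateField ℚ Qbar // FiniteDimensional ℚ F}) ∈ S := by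
    change |NumberField.discr K| ≤ _
    rw [Int.abs_eq_natAbs]
    exact_mod_cast hdisc
  have hKW : K ≤ W := le_iSup (fun K : S ↦ K.1.1) ⟨_, hKS⟩
  change W.fixingSubgroup ≤ χ.ker
  rw [← hK]
  exact IntermediateField.fixingSubgroup_antitone hKW

end Finiteness

section Counting

open scoped Finset

variable {A : Type*} [CommGroup A] [Fintype A]

/-- Finitely many `A`-extensions satisfying a tame specification are determined, up to finitely
many characters, by their inertia generators at a finite set of primes. -/
theorem exists_inertia_data {X : Set (Gal(Qbar/ℚ) →* A)}
    (hX : ∀ (χ : Gal(Qbar/ℚ) →* A) (M : IntermediateField ℚ Qbar) [FiniteDimensional ℚ M],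
      M.fixingSubgroup ≤ χ.ker → (∀ p : ℕ, p.Prime → ¬ p ∣ Nat.card A →
        ∃ τ, IsInertiaGenerator M p τ ∧ χ τ = 1) → χ ∈ X)
    {Λ : Finset ℕ} {b : ℕ → A} (hΛ : ∀ p ∈ Λ, p.Prime ∧ ¬ p ∣ Nat.card A)
    {F : Finset (AExtension A)} (hF : ∀ E ∈ F, SatisfiesSpec E Λ b) :
    ∃ (T : Finset ℕ) (f : AExtension A → ℕ → A), Λ ⊆ T ∧ (∀ p ∈ T, p.Prime) ∧
      (∀ E ∈ F, ∀ p ∈ Λ, Subgroup.zpowers (f E p) = Subgroup.zpowers (b p)) ∧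
      (∀ E ∈ F, ∏ p ∈ T, p ^ ind A (f E p) ≤ absDisc E.L) ∧
      ∀ E ∈ F, ∀ E' ∈ F, (∀ p ∈ T, f E p = f E' p) → E.toHom / E'.toHom ∈ X := by
  let M : IntermediateField ℚ Qbar := ⨆ E : F, E.1.L
  have hM : FiniteDimensional ℚ M :=
    have : ∀ E : F, @Module.Finite ℚ E.1.L _ _ E.1.L.algebra'.toModule := fun E ↦ E.1.fd
    IntermediateField.finiteDimensional_iSup_of_finite (t := fun E : F ↦ E.1.L)
  have hLM : ∀ E ∈ F, E.L ≤ M := fun E hE ↦ le_iSup (fun E : F ↦ E.1.L) ⟨E, hE⟩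
  have hmem : ∀ σ : Gal(Qbar/ℚ), σ ∈ M.fixingSubgroup ↔ ∀ E ∈ F, E.toHom σ = 1 := fun σ ↦ by
    rw [IntermediateField.fixingSubgroup_iSup, Subgroup.mem_iInf, Subtype.forall]
    refine forall₂_congr fun E _ ↦ ?_
    rw [← E.ker_toHom, MonoidHom.mem_ker]
  have hgal : IsGalois ℚ M := by
    rw [M.isGalois_rat_iff, ← InfiniteGalois.normal_iff_isGalois]
    refine ⟨fun σ hσ τ ↦ ?_⟩
    rw [hmem] at hσ ⊢
    intro E hE
    simp [hσ E hE]
  have hτ (p : ℕ) : ∃ τ, p.Prime → ¬ p ∣ Nat.card A → IsInertiaGenerator M p τ := by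
    by_cases h : p.Prime ∧ ¬ p ∣ Nat.card A
    · obtain ⟨τ, hτ⟩ := M.exists_isInertiaGenerator (m := Nat.card A)
        (fun σ τ ↦ (hmem _).mpr fun E hE ↦ by simp [mul_comm (E.toHom σ)])
        (fun σ ↦ (hmem _).mpr fun E hE ↦ by simp) h.1 h.2
      exact ⟨τ, fun _ _ ↦ hτ⟩
    · exact ⟨1, fun h1 h2 ↦ (h ⟨h1, h2⟩).elim⟩
  choose τ hτ using hτ
  let T : Finset ℕ := Λ ∪ {p ∈ (absDisc M).primeFactors | ¬ p ∣ Nat.card A}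
  have hT : ∀ p ∈ T, p.Prime ∧ ¬ p ∣ Nat.card A := fun p hp ↦ by
    rcases Finset.mem_union.mp hp with hp | hp
    · exact hΛ p hp
    · rw [Finset.mem_filter] at hp
      exact ⟨Nat.prime_of_mem_primeFactors hp.1, hp.2⟩
  refine ⟨T, fun E p ↦ E.toHom (τ p), Finset.subset_union_left, fun p hp ↦ (hT p hp).1,
    fun E hE p hp ↦ ?_, fun E hE ↦ ?_, fun E hE E' hE' h ↦ ?_⟩
  · exact (hF E hE).zpowers_eq hp (hτ p (hΛ p hp).1 (hΛ p hp).2) (hLM E hE)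
  · have := E.fd
    refine Nat.le_of_dvd (absDisc_pos E.L) (Finset.prod_dvd_of_isRelPrime (fun p hp q hq hpq ↦ ?_)
      fun p hp ↦ ?_)
    · exact Nat.coprime_iff_isRelPrime.mp
        (Nat.coprime_pow_primes _ _ (hT p hp).1 (hT q hq).1 hpq)
    · exact pow_ind_dvd_absDisc (hτ p (hT p hp).1 (hT p hp).2) (hLM E hE) (hT p hp).1
  · refine hX _ M (fun σ hσ ↦ ?_) fun p hp hpm ↦ ⟨τ p, hτ p hp hpm, ?_⟩
    · rw [hmem] at hσ
      rw [MonoidHom.mem_ker, MonoidHom.div_apply, hσ E hE, hσ E' hE', div_one]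
    · rw [MonoidHom.div_apply, div_eq_one]
      by_cases hpT : p ∈ T
      · exact h p hpT
      · have hpM : ¬ p ∣ absDisc M := fun hd ↦ hpT <| Finset.mem_union_right _ <|
          Finset.mem_filter.mpr ⟨Nat.mem_primeFactors.mpr ⟨hp, hd, (absDisc_pos M).ne'⟩, hpm⟩
        have := (hmem _).mp ((hτ p hp hpm).mem_fixingSubgroup hp hpM)
        rw [this E hE, this E' hE']

/-- A sum over a finite set whose terms are dominated by a product of local weights, and whose
fibres under the vector of local data have at most `N` elements, is at most `N` times the product
of the local sums. -/
theorem Finset.sum_le_mul_prod_sum {ι κ α : Type*} [DecidableEq κ] [DecidableEq α]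
    (F : Finset ι) (T : Finset κ) (t : κ → Finset α) (f : ι → κ → α) (u : ι → ℝ)
    (w : κ → α → ℝ) (N : ℕ) (hw : ∀ p a, 0 ≤ w p a) (hft : ∀ i ∈ F, ∀ p ∈ T, f i p ∈ t p)
    (hu : ∀ i ∈ F, u i ≤ ∏ p ∈ T, w p (f i p))
    (hN : ∀ i ∈ F, #{j ∈ F | ∀ p ∈ T, f j p = f i p} ≤ N) :
    ∑ i ∈ F, u i ≤ N * ∏ p ∈ T, ∑ a ∈ t p, w p a := by
  let g : ι → T → α := fun i p ↦ f i p
  rw [← Finset.prod_coe_sort T, Finset.prod_univ_sum, Finset.mul_sum]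
  rw [← Finset.sum_fiberwise_of_maps_to (t := Fintype.piFinset fun p : T ↦ t p) (g := g)
    fun i hi ↦ Fintype.mem_piFinset.mpr fun p ↦ hft i hi p p.2]
  refine Finset.sum_le_sum fun c _ ↦ ?_
  have hcard : #{i ∈ F | g i = c} ≤ N := by
    rcases Finset.eq_empty_or_nonempty {i ∈ F | g i = c} with h | ⟨i, hi⟩
    · simp [h]
    · rw [Finset.mem_filter] at hi
      refine le_trans (Finset.card_le_card fun j hj ↦ ?_) (hN i hi.1)
      rw [Finset.mem_filter] at hj ⊢
      exact ⟨hj.1, fun p hp ↦ congrFun (hj.2.trans hi.2.symm) ⟨p, hp⟩⟩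
  calc ∑ i ∈ F with g i = c, u i ≤ ∑ i ∈ F with g i = c, ∏ p : T, w p (c p) := by
        refine Finset.sum_le_sum fun i hi ↦ ?_
        rw [Finset.mem_filter] at hi
        rw [← hi.2, Finset.prod_coe_sort T fun p ↦ w p (f i p)]
        exact hu i hi.1
    _ = #{i ∈ F | g i = c} * ∏ p : T, w p (c p) := by simp
    _ ≤ N * ∏ p : T, w p (c p) := by
        gcongr
        exact Finset.prod_nonneg fun p _ ↦ hw _ _

end Counting

section Bound

variable {A : Type*} [CommGroup A] [Fintype A]

theorem sum_rpow_ind_le_of_zpowers_eq (g : A) (x s : ℝ) (hx : 0 ≤ x) :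
    ∑ a : A with Subgroup.zpowers a = Subgroup.zpowers g, x ^ (-(ind A a : ℝ) * s) ≤
      Fintype.card A * x ^ (-(ind A g : ℝ) * s) := by
  calc ∑ a : A with Subgroup.zpowers a = Subgroup.zpowers g, x ^ (-(ind A a : ℝ) * s)
      ≤ ∑ a : A with Subgroup.zpowers a = Subgroup.zpowers g, x ^ (-(ind A g : ℝ) * s) :=
        Finset.sum_le_sum fun a ha ↦ by rw [ind_eq_of_zpowers_eq (Finset.mem_filter.mp ha).2]
    _ ≤ ∑ a : A, x ^ (-(ind A g : ℝ) * s) :=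
        Finset.sum_le_sum_of_subset_of_nonneg (Finset.filter_subset _ _) fun _ _ _ ↦ by positivity
    _ = Fintype.card A * x ^ (-(ind A g : ℝ) * s) := by simp

theorem sum_rpow_ind_le_exp {x s : ℝ} (hx : 1 ≤ x) (hs : 0 ≤ s) :
    ∑ a : A, x ^ (-(ind A a : ℝ) * s) ≤
      Real.exp (Fintype.card A * x ^ (-(minInd A : ℝ) * s)) := by
  have h1 : ∀ a : A, x ^ (-(ind A a : ℝ) * s) ≤
      (if a = 1 then 1 else 0) + x ^ (-(minInd A : ℝ) * s) := fun a ↦ by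
    split_ifs with ha
    · refine le_add_of_le_of_nonneg ?_ (by positivity)
      refine Real.rpow_le_one_of_one_le_of_nonpos hx ?_
      rw [neg_mul, Left.neg_nonpos_iff]
      positivity
    · rw [zero_add]
      refine Real.rpow_le_rpow_of_exponent_le hx ?_
      have := minInd_le_ind ha
      gcongr
  calc ∑ a : A, x ^ (-(ind A a : ℝ) * s)
      ≤ ∑ a : A, ((if a = 1 then 1 else 0) + x ^ (-(minInd A : ℝ) * s)) :=
        Finset.sum_le_sum fun a _ ↦ h1 a
    _ = Fintype.card A * x ^ (-(minInd A : ℝ) * s) + 1 := by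
        rw [Finset.sum_add_distrib, add_comm]
        simp
    _ ≤ _ := Real.add_one_le_exp _

theorem sum_absDisc_rpow_le {X : Set (Gal(Qbar/ℚ) →* A)} (hXfin : X.Finite)
    (hX : ∀ (χ : Gal(Qbar/ℚ) →* A) (M : IntermediateField ℚ Qbar) [FiniteDimensional ℚ M],
      M.fixingSubgroup ≤ χ.ker → (∀ p : ℕ, p.Prime → ¬ p ∣ Nat.card A →
        ∃ τ, IsInertiaGenerator M p τ ∧ χ τ = 1) → χ ∈ X)
    {s : ℝ} (hs : 0 < s) (hsum : Summable fun n : ℕ ↦ (n : ℝ) ^ (-(minInd A : ℝ) * s))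
    {Λ : Finset ℕ} {b : ℕ → A} (hΛ : ∀ p ∈ Λ, p.Prime ∧ ¬ p ∣ Nat.card A)
    {F : Finset (AExtension A)} (hF : ∀ E ∈ F, SatisfiesSpec E Λ b) :
    ∑ E ∈ F, (absDisc E.L : ℝ) ^ (-s) ≤
      X.ncard * Real.exp (Fintype.card A * ∑' n : ℕ, (n : ℝ) ^ (-(minInd A : ℝ) * s)) *
        ∏ p ∈ Λ, Fintype.card A * (p : ℝ) ^ (-(ind A (b p) : ℝ) * s) := by
  obtain ⟨T, f, hΛT, hT, hfΛ, hdisc, hfib⟩ := exists_inertia_data hX hΛ hF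
  let t : ℕ → Finset A := fun p ↦
    if p ∈ Λ then Finset.univ.filter fun a ↦ Subgroup.zpowers a = Subgroup.zpowers (b p)
    else Finset.univ
  have hpos : ∀ p ∈ T, (1 : ℝ) ≤ p := fun p hp ↦ by exact_mod_cast (hT p hp).one_le
  refine (Finset.sum_le_mul_prod_sum F T t f (fun E ↦ (absDisc E.L : ℝ) ^ (-s))
    (fun p a ↦ (p : ℝ) ^ (-(ind A a : ℝ) * s)) X.ncard (fun p a ↦ by positivity)
    (fun E hE p _ ↦ ?_) (fun E hE ↦ ?_) fun E hE ↦ ?_).trans ?_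
  · by_cases hp : p ∈ Λ
    · simpa [t, hp] using hfΛ E hE p hp
    · simp [t, hp]
  · have h1 : ∏ p ∈ T, (p : ℝ) ^ (-(ind A (f E p) : ℝ) * s) =
        ((∏ p ∈ T, p ^ ind A (f E p) : ℕ) : ℝ) ^ (-s) := by
      push_cast
      rw [← Real.finsetProd_rpow _ _ fun p _ ↦ by positivity]
      refine Finset.prod_congr rfl fun p _ ↦ ?_
      rw [← Real.rpow_natCast, ← Real.rpow_mul (by positivity), neg_mul, mul_neg]
    rw [h1]
    refine Real.rpow_le_rpow_of_nonpos ?_ (by exact_mod_cast hdisc E hE) (by linarith)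
    exact_mod_cast Finset.prod_pos fun p hp ↦ pow_pos (hT p hp).pos _
  · rw [Set.ncard_eq_toFinset_card X hXfin]
    refine Finset.card_le_card_of_injOn (fun E' ↦ E'.toHom / E.toHom) (fun E' hE' ↦ ?_) ?_
    · rw [Finset.mem_coe, Finset.mem_filter] at hE'
      rw [Set.Finite.coe_toFinset]
      exact hfib E' hE'.1 E hE hE'.2
    · intro E₁ _ E₂ _ h
      exact AExtension.toHom_injective (div_left_injective h)
  · rw [mul_assoc]
    refine mul_le_mul_of_nonneg_left ?_ (Nat.cast_nonneg _)
    rw [← Finset.prod_sdiff hΛT]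
    refine mul_le_mul ?_ ?_ (Finset.prod_nonneg fun p _ ↦ Finset.sum_nonneg fun a _ ↦ by positivity)
      (Real.exp_nonneg _)
    · calc ∏ p ∈ T \ Λ, ∑ a ∈ t p, (p : ℝ) ^ (-(ind A a : ℝ) * s)
          ≤ ∏ p ∈ T \ Λ, Real.exp (Fintype.card A * (p : ℝ) ^ (-(minInd A : ℝ) * s)) := by
            refine Finset.prod_le_prod (fun p _ ↦ Finset.sum_nonneg fun a _ ↦ by positivity)
              fun p hp ↦ ?_
            rw [Finset.mem_sdiff] at hp
            simpa [t, hp.2] using sum_rpow_ind_le_exp (A := A) (hpos p hp.1) hs.le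
        _ = Real.exp (Fintype.card A * ∑ p ∈ T \ Λ, (p : ℝ) ^ (-(minInd A : ℝ) * s)) := by
            rw [← Real.exp_sum, Finset.mul_sum]
        _ ≤ _ := by
            gcongr
            exact hsum.sum_le_tsum _ fun p _ ↦ by positivity
    · refine Finset.prod_le_prod (fun p _ ↦ Finset.sum_nonneg fun a _ ↦ by positivity) fun p hp ↦ ?_
      simpa [t, hp] using sum_rpow_ind_le_of_zpowers_eq (b p) (p : ℝ) s (Nat.cast_nonneg _)

end Bound

/-- **Bound on Dirichlet values of abelian extensions with prescribed tame inertia**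
(Lemma 4.4).  Let `A` be a finite abelian group of order `m` and `s > 1/a(A)` real.
There are constants `C`, `C₀` depending only on `A` and `s` such that for every tame
local specification `Λ` (finitely many primes `p ∤ 6m`, each with a prescribed
non-identity inertia generator `b p ∈ A`), the Dirichlet value
`g_Λ(s) = Σ_L Disc(L)^{-s}`, summed over isomorphism classes of `A`-extensions of `ℚ`
satisfying `Λ`, converges and satisfies `g_Λ(s) ≤ C₀ · ∏_{p ∈ Λ} C · p^{-ind(b p)·s}`. -/
theorem dirichlet_value_bound (A : Type*) [CommGroup A] [Fintype A] [Nontrivial A]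
    (s : ℝ) (hs : 1 / (minInd A : ℝ) < s) :
    ∃ C C₀ : ℝ, 0 < C ∧ 0 < C₀ ∧ ∀ (Λ : Finset ℕ) (b : ℕ → A),
      (∀ p ∈ Λ, p.Prime ∧ ¬ p ∣ 6 * Fintype.card A ∧ b p ≠ 1) →
      Summable (fun E : {E : AExtension A // SatisfiesSpec E Λ b} =>
        (absDisc E.1.L : ℝ) ^ (-s)) ∧
      (∑' E : {E : AExtension A // SatisfiesSpec E Λ b},
          (absDisc E.1.L : ℝ) ^ (-s))
        ≤ C₀ * ∏ p ∈ Λ, C * (p : ℝ) ^ (-(ind A (b p) : ℝ) * s) := by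
  have ha : (0 : ℝ) < minInd A := by exact_mod_cast minInd_pos
  have hs0 : 0 < s := lt_trans (by positivity) hs
  have hsum : Summable fun n : ℕ ↦ (n : ℝ) ^ (-(minInd A : ℝ) * s) := by
    rw [Real.summable_nat_rpow, neg_mul, neg_lt_neg_iff, mul_comm]
    exact (div_lt_iff₀ ha).mp hs
  obtain ⟨X, hXfin, hX⟩ := exists_finite_forall_mem_of_isInertiaGenerator A
  refine ⟨Fintype.card A,
    (X.ncard + 1) * Real.exp (Fintype.card A * ∑' n : ℕ, (n : ℝ) ^ (-(minInd A : ℝ) * s)),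
    by exact_mod_cast Fintype.card_pos, by positivity, fun Λ b hΛ ↦ ?_⟩
  have hbound (F : Finset {E : AExtension A // SatisfiesSpec E Λ b}) :
      ∑ E ∈ F, (absDisc E.1.L : ℝ) ^ (-s) ≤ (X.ncard + 1) *
        Real.exp (Fintype.card A * ∑' n : ℕ, (n : ℝ) ^ (-(minInd A : ℝ) * s)) *
          ∏ p ∈ Λ, Fintype.card A * (p : ℝ) ^ (-(ind A (b p) : ℝ) * s) := by
    have h := sum_absDisc_rpow_le (b := b) (F := F.map (Function.Embedding.subtype _)) hXfin hX hs0
      hsum (fun p hp ↦ ⟨(hΛ p hp).1, fun hd ↦ (hΛ p hp).2.1 ?_⟩) fun E hE ↦ ?_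
    · rw [Finset.sum_map] at h
      refine h.trans ?_
      gcongr
      exact le_add_of_nonneg_right zero_le_one
    · rw [← Fintype.card_eq_nat_card] at hd
      exact hd.mul_left 6
    · obtain ⟨E, _, rfl⟩ := Finset.mem_map.mp hE
      exact E.2
  have hsummable := summable_of_sum_le (fun E ↦ by positivity) hbound
  exact ⟨hsummable, hsummable.tsum_le_of_sum_le hbound⟩
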